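/- Let u = p₁p₂, where p₁ < p₂ are odd primes. Then 𝒩(u), the number of full-rank well-rounded sublattices of ℤ² with determinant u, equals: 0 if p₁ ≡ 3 (mod 4) or p₂ ≡ 3 (mod 4), and p₂ > √3·p₁; 2 if p₁ ≡ 3 (mod 4) or p₂ ≡ 3 (mod 4), and p₂ ≤ √3·p₁; 4 if p₁ ≡ 1 (mod 4) and p₂ ≡ 1 (mod 4) and p₂ > √3·p₁; and 6 if p₁ ≡ 1 (mod 4) and p₂ ≡ 1 (mod 4) and p₂ ≤ √3·p₁. -/

import Mathlib

/-- The standard inner product of two vectors in `ℤ²`. -/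
def dot2 (x y : Fin 2 → ℤ) : ℤ := x 0 * y 0 + x 1 * y 1

/-- The squared Euclidean norm of a vector in `ℤ²`. -/
def normSq2 (x : Fin 2 → ℤ) : ℤ := x 0 ^ 2 + x 1 ^ 2

/-- The determinant of the pair of vectors `x`, `y` in `ℤ²`. -/
def det2 (x y : Fin 2 → ℤ) : ℤ := x 0 * y 1 - x 1 * y 0

/-- A sublattice of `ℤ²` is full-rank (rank 2) if it contains two linearly
independent vectors, i.e. its elements span `ℝ²`. -/
def IsFullRank (L : AddSubgroup (Fin 2 → ℤ)) : Prop :=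
  ∃ x ∈ L, ∃ y ∈ L, det2 x y ≠ 0

/-- `x` is a minimal vector of the lattice `L`: it is a nonzero vector of `L` of
least Euclidean norm, i.e. `‖x‖ = |L|`. -/
def IsMinVec (L : AddSubgroup (Fin 2 → ℤ)) (x : Fin 2 → ℤ) : Prop :=
  x ∈ L ∧ x ≠ 0 ∧ ∀ y ∈ L, y ≠ 0 → normSq2 x ≤ normSq2 y

/-- `L` is well-rounded: its minimal vectors span `ℝ²`, i.e. there exist two
linearly independent minimal vectors. -/
def IsWellRounded (L : AddSubgroup (Fin 2 → ℤ)) : Prop :=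
  ∃ x y, IsMinVec L x ∧ IsMinVec L y ∧ det2 x y ≠ 0

/-- The sublattice of `ℤ²` spanned over `ℤ` by the vectors `v` and `w`. -/
def latticeOf (v w : Fin 2 → ℤ) : AddSubgroup (Fin 2 → ℤ) :=
  AddSubgroup.closure {v, w}

/-- `𝒩(u)`: the number of full-rank well-rounded sublattices of `ℤ²` with
determinant (index in `ℤ²`) equal to `u`. -/
noncomputable def NWR (u : ℕ) : ℕ :=
  {Λ : AddSubgroup (Fin 2 → ℤ) | IsFullRank Λ ∧ IsWellRounded Λ ∧ Λ.index = u}.ncard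


lemma wr_gen {L : AddSubgroup (Fin 2 → ℤ)} {x y : Fin 2 → ℤ} (hx : IsMinVec L x)
    (hy : IsMinVec L y) (hD : det2 x y ≠ 0) :
    normSq2 x = normSq2 y ∧ 2 * |dot2 x y| ≤ normSq2 x ∧
      ∀ v ∈ L, ∃ a b : ℤ, v = a • x + b • y := by
  have hN : normSq2 x = normSq2 y := le_antisymm (hx.2.2 y hy.1 hy.2.1) (hy.2.2 x hx.1 hx.2.1)
  have hd : 2 * |dot2 x y| ≤ normSq2 x := by
    have h1 : x + y ≠ 0 := by
      intro h
      have h0 := congrFun h 0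
      have h1 := congrFun h 1
      simp at h0 h1
      apply hD
      unfold det2
      rw [show x 0 = - y 0 by linarith, show x 1 = - y 1 by linarith]; ring
    have h2 : x - y ≠ 0 := by
      intro h
      have h0 := congrFun h 0
      have h1 := congrFun h 1
      simp at h0 h1
      apply hD
      unfold det2
      rw [show x 0 = y 0 by linarith, show x 1 = y 1 by linarith]; ring
    have e1 := hx.2.2 _ (L.add_mem hx.1 hy.1) h1
    have e2 := hx.2.2 _ (L.sub_mem hx.1 hy.1) h2
    simp only [normSq2, dot2, Pi.add_apply, Pi.sub_apply] at *
    rcases abs_cases (x 0 * y 0 + x 1 * y 1) with h | h <;> rw [h.1] <;> nlinarith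
  refine ⟨hN, hd, ?_⟩
  intro v hv
  set D := det2 x y with hDdef
  -- rounding
  have hround : ∀ n : ℤ, ∃ a : ℤ, 2 * |n - a * D| ≤ |D| := by
    intro n
    refine ⟨round ((n : ℚ) / D), ?_⟩
    have := abs_sub_round ((n : ℚ) / D)
    have hDq : (D : ℚ) ≠ 0 := by exact_mod_cast hD
    have h3 : (n : ℚ) - round ((n : ℚ) / D) * D = ((n : ℚ) / D - round ((n : ℚ) / D)) * D := by
      field_simp
    have h4 : |(n : ℚ) - round ((n : ℚ) / D) * D| ≤ 1 / 2 * |(D : ℚ)| := by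
      rw [h3, abs_mul]; gcongr
    have h5 : 2 * |(n : ℚ) - round ((n : ℚ) / D) * D| ≤ |(D : ℚ)| := by linarith
    exact_mod_cast h5
  obtain ⟨a, ha⟩ := hround (det2 v y)
  obtain ⟨b, hb⟩ := hround (det2 x v)
  refine ⟨a, b, ?_⟩
  by_contra hne
  have hw : v - (a • x + b • y) ∈ L :=
    L.sub_mem hv (L.add_mem (L.zsmul_mem hx.1 a) (L.zsmul_mem hy.1 b))
  have hw0 : v - (a • x + b • y) ≠ 0 := sub_ne_zero.mpr hne
  have hmin := hx.2.2 _ hw hw0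
  set α := det2 v y - a * D with hα
  set β := det2 x v - b * D with hβ
  have key : D ^ 2 * normSq2 (v - (a • x + b • y)) =
      (α ^ 2 + β ^ 2) * normSq2 x + 2 * (α * β) * dot2 x y := by
    have : (α ^ 2 + β ^ 2) * normSq2 x = α ^ 2 * normSq2 x + β ^ 2 * normSq2 y := by
      rw [← hN]; ring
    rw [this, hα, hβ, hDdef]
    simp only [normSq2, dot2, det2, Pi.add_apply, Pi.sub_apply, Pi.smul_apply, smul_eq_mul]
    ring
  have hNpos : 0 < normSq2 x := by
    have : normSq2 x ≠ 0 := by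
      intro h
      apply hD
      rw [hDdef]
      simp only [normSq2, det2] at *
      have h0 : x 0 = 0 := by nlinarith [sq_nonneg (x 0), sq_nonneg (x 1)]
      have h1 : x 1 = 0 := by nlinarith [sq_nonneg (x 0), sq_nonneg (x 1)]
      rw [h0, h1]; ring
    have h2 : 0 ≤ normSq2 x := by unfold normSq2; positivity
    omega
  have hDpos : 0 < D ^ 2 := by positivity
  have h1 : 4 * α ^ 2 ≤ D ^ 2 := by
    rw [← sq_abs α, ← sq_abs D]; nlinarith [abs_nonneg α, abs_nonneg D]
  have h2 : 4 * β ^ 2 ≤ D ^ 2 := by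
    rw [← sq_abs β, ← sq_abs D]; nlinarith [abs_nonneg β, abs_nonneg D]
  have h3 : 4 * |α * β| ≤ D ^ 2 := by
    rw [abs_mul, ← sq_abs D]; nlinarith [abs_nonneg α, abs_nonneg β, abs_nonneg D]
  have h4 : 2 * (α * β) * dot2 x y ≤ |α * β| * normSq2 x := by
    calc 2 * (α * β) * dot2 x y ≤ |2 * (α * β) * dot2 x y| := le_abs_self _
      _ = |α * β| * (2 * |dot2 x y|) := by rw [abs_mul, abs_mul]; norm_num; ring
      _ ≤ _ := by gcongr
  have h5 : D ^ 2 * normSq2 x ≤ (α ^ 2 + β ^ 2 + |α * β|) * normSq2 x := by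
    calc _ ≤ D ^ 2 * normSq2 (v - (a • x + b • y)) := by gcongr
      _ = _ := key
      _ ≤ _ := by linarith
  have h6 := le_of_mul_le_mul_right h5 hNpos
  linarith

lemma wr_index {L : AddSubgroup (Fin 2 → ℤ)} {x y : Fin 2 → ℤ} (hx : x ∈ L) (hy : y ∈ L)
    (hD : det2 x y ≠ 0) (hg : ∀ v ∈ L, ∃ a b : ℤ, v = a • x + b • y) :
    L.index = (det2 x y).natAbs := by
  have hli : LinearIndependent ℤ ![(⟨x, hx⟩ : L), ⟨y, hy⟩] := by
    rw [LinearIndependent.pair_iff]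
    intro s t hst
    have hst' : s • x + t • y = 0 := by
      have := congrArg Subtype.val hst
      simpa using this
    have h0 := congrFun hst' 0
    have h1 := congrFun hst' 1
    simp at h0 h1
    constructor
    · have : s * det2 x y = 0 := by unfold det2; linear_combination y 1 * h0 - y 0 * h1
      exact (mul_eq_zero.mp this).resolve_right hD
    · have : t * det2 x y = 0 := by unfold det2; linear_combination x 0 * h1 - x 1 * h0
      exact (mul_eq_zero.mp this).resolve_right hD
  have hsp : ⊤ ≤ Submodule.span ℤ (Set.range ![(⟨x, hx⟩ : L), ⟨y, hy⟩]) := by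
    rintro ⟨v, hv⟩ -
    obtain ⟨a, b, hab⟩ := hg v hv
    rw [Matrix.range_cons, Matrix.range_cons, Matrix.range_empty, Set.union_empty,
      Set.singleton_union, Submodule.mem_span_pair]
    refine ⟨a, b, ?_⟩
    apply Subtype.ext
    simp [hab]
  rw [AddSubgroup.index_eq_natAbs_det (Pi.basisFun ℤ (Fin 2)) L (Module.Basis.mk hli hsp)]
  congr 1
  rw [Module.Basis.det_apply, Matrix.det_fin_two]
  simp [Module.Basis.toMatrix, det2]
  ring

lemma eq_of_le_index {L M : AddSubgroup (Fin 2 → ℤ)} (h : L ≤ M) (hi : L.index = M.index)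
    (h0 : M.index ≠ 0) : L = M := by
  have := AddSubgroup.relIndex_mul_index h
  rw [hi] at this
  have h1 : L.relIndex M = 1 := by
    have : L.relIndex M * M.index = 1 * M.index := by rw [this, one_mul]
    exact Nat.eq_of_mul_eq_mul_right (Nat.pos_of_ne_zero h0) this
  exact le_antisymm h (AddSubgroup.relIndex_eq_one.mp h1)

/-- The lattice of vectors with `v 0 = c₁ v 1` mod `p` and `v 0 = c₂ v 1` mod `q`. -/
def cMap (p q : ℕ) (c : ZMod p × ZMod q) : (Fin 2 → ℤ) →+ ZMod p × ZMod q where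
  toFun v := ((v 0 : ZMod p) - c.1 * v 1, (v 0 : ZMod q) - c.2 * v 1)
  map_zero' := by simp
  map_add' v w := by ext <;> simp <;> ring

def cLat (p q : ℕ) (c : ZMod p × ZMod q) : AddSubgroup (Fin 2 → ℤ) := (cMap p q c).ker

lemma mem_cLat {p q : ℕ} {c : ZMod p × ZMod q} {v : Fin 2 → ℤ} :
    v ∈ cLat p q c ↔ (v 0 : ZMod p) = c.1 * v 1 ∧ (v 0 : ZMod q) = c.2 * v 1 := by
  rw [cLat, AddMonoidHom.mem_ker]
  simp [cMap, Prod.ext_iff, sub_eq_zero]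

lemma crt {p q : ℕ} (h : p.Coprime q) (c : ZMod p × ZMod q) :
    ∃ n : ℤ, (n : ZMod p) = c.1 ∧ (n : ZMod q) = c.2 := by
  obtain ⟨z, hz⟩ := (ZMod.chineseRemainder h).surjective c
  obtain ⟨n, rfl⟩ := ZMod.intCast_surjective z
  rw [map_intCast] at hz
  exact ⟨n, by rw [← hz]; simp, by rw [← hz]; simp⟩

lemma cLat_index {p q : ℕ} (h : p.Coprime q) (c : ZMod p × ZMod q) :
    (cLat p q c).index = p * q := by
  have hs : Function.Surjective (cMap p q c) := by
    intro d
    obtain ⟨n, h1, h2⟩ := crt h d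
    refine ⟨![n, 0], ?_⟩
    ext <;> simp [cMap, h1, h2]
  rw [cLat, AddSubgroup.index_ker, AddMonoidHom.range_eq_top.mpr hs]
  simp [Nat.card_prod]

lemma cLat_inj {p q : ℕ} (h : p.Coprime q) : Function.Injective (cLat p q) := by
  intro c d hcd
  obtain ⟨n, h1, h2⟩ := crt h c
  have hm : ![n, 1] ∈ cLat p q c := by rw [mem_cLat]; simp [h1, h2]
  rw [hcd, mem_cLat] at hm
  simp [h1, h2] at hm
  exact Prod.ext hm.1 hm.2

lemma normSq2_pos {x : Fin 2 → ℤ} (hx : x ≠ 0) : 0 < normSq2 x := by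
  have h2 : 0 ≤ normSq2 x := by unfold normSq2; positivity
  have : normSq2 x ≠ 0 := by
    intro h
    apply hx
    simp only [normSq2] at *
    have h0 : x 0 = 0 := by nlinarith [sq_nonneg (x 0), sq_nonneg (x 1)]
    have h1 : x 1 = 0 := by nlinarith [sq_nonneg (x 0), sq_nonneg (x 1)]
    ext i; fin_cases i <;> simp [h0, h1]
  omega

lemma exists_min {L : AddSubgroup (Fin 2 → ℤ)} (hL : ∃ x ∈ L, x ≠ 0) : ∃ x, IsMinVec L x := by
  obtain ⟨x, hx⟩ := hL
  classical
  have hex : ∃ n : ℕ, ∃ x, (x ∈ L ∧ x ≠ 0) ∧ (normSq2 x).toNat = n := ⟨_, x, hx, rfl⟩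
  obtain ⟨m, hm, hmn⟩ := Nat.find_spec hex
  refine ⟨m, hm.1, hm.2, fun y hy hy0 => ?_⟩
  have h1 := Nat.find_min' hex ⟨y, ⟨hy, hy0⟩, rfl⟩
  have := normSq2_pos hm.2
  have := normSq2_pos hy0
  omega

lemma sq_wr {p q : ℕ} (hp : p ≠ 0) (hq : q ≠ 0) {c : ZMod p × ZMod q} (h1 : c.1 ^ 2 = -1)
    (h2 : c.2 ^ 2 = -1) : IsWellRounded (cLat p q c) := by
  obtain ⟨x, hx⟩ : ∃ x, IsMinVec (cLat p q c) x := by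
    apply exists_min
    refine ⟨![p * q, 0], ?_, ?_⟩
    · rw [mem_cLat]; simp
    · intro h
      have := congrFun h 0
      simp [hp, hq] at this
  refine ⟨x, ![-x 1, x 0], hx, ⟨?_, ?_, ?_⟩, ?_⟩
  · have := hx.1
    rw [mem_cLat] at this ⊢
    simp
    constructor
    · rw [this.1]; linear_combination (-(x 1 : ZMod p)) * h1
    · rw [this.2]; linear_combination (-(x 1 : ZMod q)) * h2
  · intro h
    apply hx.2.1
    have e0 := congrFun h 0
    have e1 := congrFun h 1
    simp at e0 e1
    ext i; fin_cases i <;> simp [e0, e1]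
  · intro y hy hy0
    have := hx.2.2 y hy hy0
    refine le_trans (le_of_eq ?_) this
    simp [normSq2]; ring
  · have := normSq2_pos hx.2.1
    simp [normSq2, det2] at *
    nlinarith

lemma rect_wr {L : AddSubgroup (Fin 2 → ℤ)} {a b : ℤ} (ha : Odd a) (hb : Odd b) (ha0 : 0 < a)
    (hb0 : 0 < b) (hL : ∀ v, v ∈ L ↔ a ∣ v 0 + v 1 ∧ b ∣ v 0 - v 1)
    (h1 : a ^ 2 ≤ 3 * b ^ 2) (h2 : b ^ 2 ≤ 3 * a ^ 2) : IsWellRounded L := by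
  obtain ⟨k, hk⟩ := ha
  obtain ⟨l, hl⟩ := hb
  have hmin : ∀ y ∈ L, y ≠ 0 → a ^ 2 + b ^ 2 ≤ 2 * normSq2 y := by
    intro y hy hy0
    obtain ⟨⟨i, hi⟩, ⟨j, hj⟩⟩ := (hL y).1 hy
    have e : 2 * (2 * normSq2 y) = 2 * (a ^ 2 * i ^ 2 + b ^ 2 * j ^ 2) := by
      unfold normSq2
      linear_combination 2 * (y 0 + y 1 + a * i) * hi + 2 * (y 0 - y 1 + b * j) * hj
    have e' : 2 * normSq2 y = a ^ 2 * i ^ 2 + b ^ 2 * j ^ 2 := by linarith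
    have hpar : (2 : ℤ) ∣ i - j := by
      refine ⟨y 1 - k * i + l * j, ?_⟩
      have : a * i - b * j = 2 * y 1 := by linarith
      rw [hk, hl] at this
      linarith
    rw [e']
    have sqge : ∀ n : ℤ, n ≠ 0 → 1 ≤ n ^ 2 := fun n hn => by
      have : 0 < n ^ 2 := by positivity
      omega
    by_cases hi0 : i = 0
    · subst hi0
      obtain ⟨m, hm⟩ := hpar
      have hm0 : m ≠ 0 := by
        rintro rfl
        have hj0 : j = 0 := by omega
        subst hj0
        apply hy0
        ext t; fin_cases t <;> simp <;> omega
      have hj2 : j = -2 * m := by linarith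
      have := sqge m hm0
      rw [hj2]; nlinarith [sq_nonneg b]
    · by_cases hj0 : j = 0
      · subst hj0
        obtain ⟨m, hm⟩ := hpar
        have hm0 : m ≠ 0 := by
          rintro rfl
          omega
        have hj2 : i = 2 * m := by linarith
        have := sqge m hm0
        rw [hj2]; nlinarith [sq_nonneg a]
      · nlinarith [sqge i hi0, sqge j hj0, sq_nonneg a, sq_nonneg b]
  have hdet : det2 ![k + l + 1, k - l] ![k - l, k + l + 1] ≠ 0 := by
    have : det2 ![k + l + 1, k - l] ![k - l, k + l + 1] = a * b := by
      simp [det2, hk, hl]; ring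
    rw [this]; positivity
  refine ⟨![k + l + 1, k - l], ![k - l, k + l + 1], ⟨?_, ?_, ?_⟩, ⟨?_, ?_, ?_⟩, hdet⟩
  · rw [hL]; simp only [Matrix.cons_val_zero, Matrix.cons_val_one]
    exact ⟨⟨1, by rw [hk]; ring⟩, ⟨1, by rw [hl]; ring⟩⟩
  · intro h; apply hdet; rw [h]; simp [det2]
  · intro y hy hy0
    have := hmin y hy hy0
    have e : 2 * normSq2 ![k + l + 1, k - l] = a ^ 2 + b ^ 2 := by simp [normSq2, hk, hl]; ring
    linarith
  · rw [hL]; simp only [Matrix.cons_val_zero, Matrix.cons_val_one]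
    exact ⟨⟨1, by rw [hk]; ring⟩, ⟨-1, by rw [hl]; ring⟩⟩
  · intro h; apply hdet; rw [h]; simp [det2]
  · intro y hy hy0
    have := hmin y hy hy0
    have e : 2 * normSq2 ![k - l, k + l + 1] = a ^ 2 + b ^ 2 := by simp [normSq2, hk, hl]; ring
    linarith

lemma zmod_eq_iff {p : ℕ} (a b : ℤ) : (a : ZMod p) = b ↔ (p : ℤ) ∣ a - b := by
  rw [← ZMod.intCast_zmod_eq_zero_iff_dvd]; push_cast; rw [sub_eq_zero]

lemma mem_pm {p q : ℕ} (v : Fin 2 → ℤ) :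
    v ∈ cLat p q (1, -1) ↔ (q : ℤ) ∣ v 0 + v 1 ∧ (p : ℤ) ∣ v 0 - v 1 := by
  rw [mem_cLat, and_comm, ← zmod_eq_iff, ← sub_neg_eq_add, ← zmod_eq_iff]; simp

lemma mem_mp {p q : ℕ} (v : Fin 2 → ℤ) :
    v ∈ cLat p q (-1, 1) ↔ (p : ℤ) ∣ v 0 + v 1 ∧ (q : ℤ) ∣ v 0 - v 1 := by
  rw [mem_cLat, ← zmod_eq_iff, ← sub_neg_eq_add, ← zmod_eq_iff]; simp

lemma div_cases {p q : ℕ} (hp : p.Prime) (hq : q.Prime) (hp3 : 3 ≤ p) (hlt : p < q) {A B : ℕ}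
    (hAB : A * B = p ^ 2 * q ^ 2) (hle : A ≤ B) (h3 : B ≤ 3 * A) :
    (A = p * q ∧ B = p * q) ∨ (A = p ^ 2 ∧ B = q ^ 2) := by
  obtain ⟨a, b, ha, hb, hab⟩ := (Nat.dvd_mul (k := A)).1 ⟨B, hAB.symm⟩
  obtain ⟨i, hi, rfl⟩ := (Nat.dvd_prime_pow hp).1 ha
  obtain ⟨j, hj, rfl⟩ := (Nat.dvd_prime_pow hq).1 hb
  have hp0 : 0 < p := by omega
  have hq0 : 0 < q := by omega
  have canc : ∀ C, A * C = p ^ 2 * q ^ 2 → B = C := by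
    intro C hC
    have hA : 0 < A := by rw [← hab]; positivity
    exact Nat.eq_of_mul_eq_mul_left hA (hAB.trans hC.symm)
  have hpp : 9 ≤ p ^ 2 := by nlinarith
  have hqq : 9 ≤ q ^ 2 := by nlinarith
  have hpq : p ^ 2 < q ^ 2 := by nlinarith
  interval_cases i <;> interval_cases j <;> try simp only [pow_zero, pow_one, one_mul, mul_one] at hab
  · have := canc (p ^ 2 * q ^ 2) (by rw [← hab]; ring)
    nlinarith
  · have := canc (p ^ 2 * q) (by rw [← hab]; ring)
    nlinarith
  · have := canc (p ^ 2) (by rw [← hab]; ring)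
    omega
  · have := canc (p * q ^ 2) (by rw [← hab]; ring)
    nlinarith
  · have := canc (p * q) (by rw [← hab]; ring)
    left; exact ⟨hab.symm, this⟩
  · have := canc p (by rw [← hab]; ring)
    nlinarith
  · have := canc (q ^ 2) (by rw [← hab])
    right; exact ⟨hab.symm, this⟩
  · have := canc q (by rw [← hab]; ring)
    nlinarith
  · have := canc 1 (by rw [← hab]; ring)
    nlinarith

lemma root_ex {p : ℕ} (hp : p.Prime) {m n : ℤ} (h1 : (p : ℤ) ∣ m ^ 2 + n ^ 2)
    (h2 : ¬ (p : ℤ) ^ 2 ∣ m ^ 2 + n ^ 2) : ∃ c : ZMod p, c ^ 2 = -1 ∧ (m : ZMod p) = c * n := by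
  have : Fact p.Prime := ⟨hp⟩
  have hz : (m : ZMod p) ^ 2 + (n : ZMod p) ^ 2 = 0 := by
    have := (ZMod.intCast_zmod_eq_zero_iff_dvd _ p).2 h1
    exact_mod_cast this
  have hn : (n : ZMod p) ≠ 0 := by
    intro hn
    rw [hn] at hz
    have hm : (m : ZMod p) = 0 := by simpa using hz
    rw [ZMod.intCast_zmod_eq_zero_iff_dvd] at hn hm
    exact h2 (dvd_add (pow_dvd_pow_of_dvd hm 2) (pow_dvd_pow_of_dvd hn 2))
  refine ⟨m / n, ?_, by field_simp⟩
  field_simp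
  linear_combination hz

def Good (p q : ℕ) (c : ZMod p × ZMod q) : Prop :=
  (c.1 ^ 2 = -1 ∧ c.2 ^ 2 = -1) ∨ (q ^ 2 ≤ 3 * p ^ 2 ∧ (c = (1, -1) ∨ c = (-1, 1)))

lemma sum_two {e f : ℤ} (hef : e ^ 2 + f ^ 2 = 2) : e = 1 ∨ e = -1 := by
  have : -1 ≤ e := by nlinarith [sq_nonneg f]
  have : e ≤ 1 := by nlinarith [sq_nonneg f]
  interval_cases e
  · right; rfl
  · exfalso
    have : f ≤ 1 := by nlinarith
    have : -1 ≤ f := by nlinarith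
    interval_cases f <;> omega
  · left; rfl

set_option maxHeartbeats 1000000 in
lemma core {p q : ℕ} (hp : p.Prime) (hq : q.Prime) (hp3 : 3 ≤ p) (hlt : p < q)
    {x y : Fin 2 → ℤ} (hN : normSq2 x = normSq2 y) (hd0 : 0 ≤ dot2 x y)
    (hd : 2 * dot2 x y ≤ normSq2 x) {ε : ℤ} (hε : ε ^ 2 = 1) (hD : det2 x y = ε * (p * q)) :
    ∃ c, Good p q c ∧ x ∈ cLat p q c ∧ y ∈ cLat p q c := by
  have hp0 : (p : ℤ) ≠ 0 := by exact_mod_cast hp.ne_zero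
  have hq0 : (q : ℤ) ≠ 0 := by exact_mod_cast hq.ne_zero
  have hcop : IsCoprime (p : ℤ) q :=
    Nat.isCoprime_iff_coprime.mpr ((Nat.coprime_primes hp hq).2 hlt.ne)
  have hlag : normSq2 x * normSq2 y = dot2 x y ^ 2 + det2 x y ^ 2 := by
    simp only [normSq2, dot2, det2]; ring
  have hprod : (normSq2 x - dot2 x y) * (normSq2 x + dot2 x y) = p ^ 2 * q ^ 2 := by
    rw [hD, ← hN] at hlag
    linear_combination hlag + (p : ℤ) ^ 2 * q ^ 2 * hε
  obtain ⟨A, hA⟩ := Int.eq_ofNat_of_zero_le (a := normSq2 x - dot2 x y) (by linarith)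
  obtain ⟨B, hB⟩ := Int.eq_ofNat_of_zero_le (a := normSq2 x + dot2 x y) (by linarith)
  rw [hA, hB] at hprod
  rcases div_cases hp hq hp3 hlt (A := A) (B := B) (by exact_mod_cast hprod) (by omega) (by omega)
    with ⟨h1, h2⟩ | ⟨h1, h2⟩
  · have hdz : dot2 x y = 0 := by omega
    have hNu : normSq2 x = p * q := by rw [hdz, h1] at hA; push_cast at hA; linarith
    have hu0 : (p * q : ℤ) ≠ 0 := mul_ne_zero hp0 hq0
    have hy0 : y 0 = - ε * x 1 := by
      apply mul_left_cancel₀ hu0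
      have : (p * q : ℤ) * y 0 = x 0 * dot2 x y - x 1 * det2 x y := by
        rw [← hNu]; simp only [normSq2, dot2, det2]; ring
      rw [this, hdz, hD]; ring
    have hy1 : y 1 = ε * x 0 := by
      apply mul_left_cancel₀ hu0
      have : (p * q : ℤ) * y 1 = x 1 * dot2 x y + x 0 * det2 x y := by
        rw [← hNu]; simp only [normSq2, dot2, det2]; ring
      rw [this, hdz, hD]; ring
    have hNu' : x 0 ^ 2 + x 1 ^ 2 = p * q := hNu
    obtain ⟨c1, hc1, hx1⟩ := root_ex hp (m := x 0) (n := x 1) (by rw [hNu']; exact ⟨q, rfl⟩) (by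
      rw [hNu']
      intro h
      have h' : p * p ∣ p * q := by rw [sq] at h; exact_mod_cast h
      have := Nat.dvd_of_mul_dvd_mul_left hp.pos h'
      exact hlt.ne ((Nat.prime_dvd_prime_iff_eq hp hq).1 this))
    obtain ⟨c2, hc2, hx2⟩ := root_ex hq (m := x 0) (n := x 1)
      (by rw [hNu']; exact ⟨p, mul_comm _ _⟩) (by
      rw [hNu']
      intro h
      have h' : q * q ∣ p * q := by rw [sq] at h; exact_mod_cast h
      have := Nat.dvd_of_mul_dvd_mul_right hq.pos h'
      exact hlt.ne' ((Nat.prime_dvd_prime_iff_eq hq hp).1 this))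
    refine ⟨(c1, c2), Or.inl ⟨hc1, hc2⟩, ?_, ?_⟩
    · rw [mem_cLat]; exact ⟨hx1, hx2⟩
    · rw [mem_cLat, hy0, hy1]
      push_cast
      rw [hx1, hx2]
      constructor
      · linear_combination (-(ε : ZMod p) * x 1) * hc1
      · linear_combination (-(ε : ZMod q) * x 1) * hc2
  · have hrat : q ^ 2 ≤ 3 * p ^ 2 := by omega
    rw [h1] at hA
    rw [h2] at hB
    push_cast at hA hB
    have hp2 : (2 * p ^ 2 : ℤ) ≠ 0 := by positivity
    have ht : (x 0 - y 0) ^ 2 + (x 1 - y 1) ^ 2 = 2 * p ^ 2 := by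
      simp only [normSq2, dot2] at *; linarith
    have hs : (x 0 + y 0) ^ 2 + (x 1 + y 1) ^ 2 = 2 * q ^ 2 := by
      simp only [normSq2, dot2] at *; linarith
    have hdot : (x 0 + y 0) * (x 0 - y 0) + (x 1 + y 1) * (x 1 - y 1) = 0 := by
      simp only [normSq2] at *; linarith
    have hdet : (x 0 + y 0) * (x 1 - y 1) - (x 1 + y 1) * (x 0 - y 0) = -2 * ε * (p * q) := by
      simp only [det2] at *; linarith
    have e0 : (p : ℤ) * (x 0 + y 0) = - ε * q * (x 1 - y 1) := by
      apply mul_left_cancel₀ (mul_ne_zero two_ne_zero hp0)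
      linear_combination (x 1 - y 1) * hdet + (x 0 - y 0) * hdot - (x 0 + y 0) * ht
    have e1 : (p : ℤ) * (x 1 + y 1) = ε * q * (x 0 - y 0) := by
      apply mul_left_cancel₀ (mul_ne_zero two_ne_zero hp0)
      linear_combination (-(x 0 - y 0)) * hdet + (x 1 - y 1) * hdot - (x 1 + y 1) * ht
    obtain ⟨e, he⟩ : (q : ℤ) ∣ x 0 + y 0 :=
      hcop.symm.dvd_of_dvd_mul_left ⟨- ε * (x 1 - y 1), by rw [e0]; ring⟩
    obtain ⟨f, hf⟩ : (q : ℤ) ∣ x 1 + y 1 :=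
      hcop.symm.dvd_of_dvd_mul_left ⟨ε * (x 0 - y 0), by rw [e1]; ring⟩
    have ht1 : x 1 - y 1 = - ε * p * e := by
      apply mul_left_cancel₀ hq0
      rw [he] at e0
      linear_combination ε * e0 - (q : ℤ) * (x 1 - y 1) * hε
    have ht0 : x 0 - y 0 = ε * p * f := by
      apply mul_left_cancel₀ hq0
      rw [hf] at e1
      linear_combination (-ε) * e1 - (q : ℤ) * (x 0 - y 0) * hε
    have hef : e ^ 2 + f ^ 2 = 2 := by
      apply mul_left_cancel₀ (pow_ne_zero 2 hq0)
      rw [he, hf] at hs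
      linarith
    have heb := sum_two hef
    have hff : f = e ∨ f = -e := by
      have : (f - e) * (f + e) = 0 := by rcases heb with rfl | rfl <;> linarith
      rcases mul_eq_zero.1 this with h | h
      · left; linarith
      · right; linarith
    rcases hff with rfl | rfl
    · refine ⟨(1, -1), Or.inr ⟨hrat, Or.inl rfl⟩, ?_, ?_⟩
      · rw [mem_pm]; exact ⟨⟨f, by linarith⟩, ⟨ε * f, by linarith⟩⟩
      · rw [mem_pm]; exact ⟨⟨f, by linarith⟩, ⟨-ε * f, by linarith⟩⟩
    · refine ⟨(-1, 1), Or.inr ⟨hrat, Or.inr rfl⟩, ?_, ?_⟩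
      · rw [mem_mp]; exact ⟨⟨-ε * e, by linarith⟩, ⟨e, by linarith⟩⟩
      · rw [mem_mp]; exact ⟨⟨ε * e, by linarith⟩, ⟨e, by linarith⟩⟩

lemma wr_set {p q : ℕ} (hp : p.Prime) (hq : q.Prime) (hop : Odd p) (hoq : Odd q) (hlt : p < q) :
    {Λ : AddSubgroup (Fin 2 → ℤ) | IsFullRank Λ ∧ IsWellRounded Λ ∧ Λ.index = p * q} =
      cLat p q '' {c | Good p q c} := by
  have hcop := (Nat.coprime_primes hp hq).2 hlt.ne
  have hp3 : 3 ≤ p := by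
    have := hp.two_le
    obtain ⟨k, hk⟩ := hop
    omega
  ext L
  simp only [Set.mem_ofPred_eq, Set.mem_image]
  constructor
  · rintro ⟨-, ⟨x, y, hx, hy, hD⟩, hi⟩
    obtain ⟨hN, hd, hg⟩ := wr_gen hx hy hD
    have hidx := wr_index hx.1 hy.1 hD hg
    rw [hi] at hidx
    have hsg : ∃ ε : ℤ, ε ^ 2 = 1 ∧ det2 x y = ε * (p * q) := by
      rcases Int.natAbs_eq (det2 x y) with h | h
      · exact ⟨1, by norm_num, by rw [h, ← hidx]; push_cast; ring⟩
      · exact ⟨-1, by norm_num, by rw [h, ← hidx]; push_cast; ring⟩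
    obtain ⟨ε, hε, hdet⟩ := hsg
    have hc : ∃ c, Good p q c ∧ x ∈ cLat p q c ∧ y ∈ cLat p q c := by
      rcases le_total 0 (dot2 x y) with h | h
      · rw [abs_of_nonneg h] at hd
        exact core hp hq hp3 hlt hN h hd hε hdet
      · rw [abs_of_nonpos h] at hd
        have hdn : dot2 x (-y) = - dot2 x y := by simp [dot2]; ring
        obtain ⟨c, h1, h2, h3⟩ := core hp hq hp3 hlt (x := x) (y := -y) (ε := -ε)
          (by rw [hN]; simp [normSq2]) (by rw [hdn]; linarith) (by rw [hdn]; exact hd)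
          (by rw [neg_sq, hε]) (by
            have : det2 x (-y) = - det2 x y := by simp [det2]; ring
            rw [this, hdet]; ring)
        exact ⟨c, h1, h2, by simpa using (cLat p q c).neg_mem h3⟩
    obtain ⟨c, hG, hxc, hyc⟩ := hc
    refine ⟨c, hG, ?_⟩
    symm
    apply eq_of_le_index
    · intro v hv
      obtain ⟨a, b, rfl⟩ := hg v hv
      exact AddSubgroup.add_mem _ (AddSubgroup.zsmul_mem _ hxc a) (AddSubgroup.zsmul_mem _ hyc b)
    · rw [hi, cLat_index hcop]
    · rw [cLat_index hcop]; exact mul_ne_zero hp.ne_zero hq.ne_zero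
  · rintro ⟨c, hG, rfl⟩
    have hwr : IsWellRounded (cLat p q c) := by
      have hpz : (0 : ℤ) < p := by exact_mod_cast hp.pos
      have hqz : (0 : ℤ) < q := by exact_mod_cast hq.pos
      have hlz : (p : ℤ) < q := by exact_mod_cast hlt
      have hopz : Odd (p : ℤ) := by exact_mod_cast hop
      have hoqz : Odd (q : ℤ) := by exact_mod_cast hoq
      rcases hG with ⟨h1, h2⟩ | ⟨h, rfl | rfl⟩
      · exact sq_wr hp.ne_zero hq.ne_zero h1 h2
      · have h' : (q : ℤ) ^ 2 ≤ 3 * p ^ 2 := by exact_mod_cast h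
        exact rect_wr hoqz hopz hqz hpz mem_pm h' (by nlinarith)
      · have h' : (q : ℤ) ^ 2 ≤ 3 * p ^ 2 := by exact_mod_cast h
        exact rect_wr hopz hoqz hpz hqz mem_mp (by nlinarith) h'
    obtain ⟨x, y, hx, hy, hD⟩ := id hwr
    exact ⟨⟨x, hx.1, y, hy.1, hD⟩, hwr, cLat_index hcop c⟩

lemma nwr_eq {p q : ℕ} (hp : p.Prime) (hq : q.Prime) (hop : Odd p) (hoq : Odd q) (hlt : p < q) :
    NWR (p * q) = {c | Good p q c}.ncard := by
  rw [NWR, wr_set hp hq hop hoq hlt]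
  exact Set.ncard_image_of_injective _ (cLat_inj ((Nat.coprime_primes hp hq).2 hlt.ne))

lemma roots_three {p : ℕ} (hp : p.Prime) (h : p % 4 = 3) (c : ZMod p) : c ^ 2 ≠ -1 := by
  have : Fact p.Prime := ⟨hp⟩
  intro hc
  exact ZMod.exists_sq_eq_neg_one_iff.1 ⟨c, by rw [← hc, sq]⟩ h

lemma neg_ne_self' {p : ℕ} (hp : p.Prime) (ho : Odd p) {c : ZMod p} (hc : c ≠ 0) : c ≠ -c := by
  have : Fact p.Prime := ⟨hp⟩
  have h2 : p ≠ 2 := by rintro rfl; exact absurd ho (by decide)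
  have : Fact (2 < p) := ⟨lt_of_le_of_ne hp.two_le h2.symm⟩
  intro h
  exact ZMod.neg_one_ne_one (n := p) (mul_right_cancel₀ hc (by rw [neg_one_mul, one_mul, ← h]))

lemma roots_one {p : ℕ} (hp : p.Prime) (h : p % 4 = 1) : {c : ZMod p | c ^ 2 = -1}.ncard = 2 := by
  have : Fact p.Prime := ⟨hp⟩
  obtain ⟨i, hi⟩ := ZMod.exists_sq_eq_neg_one_iff.2 (show p % 4 ≠ 3 by omega)
  have hi' : i ^ 2 = -1 := by rw [sq, hi]
  have hi0 : i ≠ 0 := by rintro rfl; simp at hi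
  have : {c : ZMod p | c ^ 2 = -1} = {i, -i} := by
    ext c
    simp only [Set.mem_ofPred_eq, Set.mem_insert_iff, Set.mem_singleton_iff]
    rw [← hi', sq_eq_sq_iff_eq_or_eq_neg]
  rw [this]
  exact Set.ncard_pair (neg_ne_self' hp (Nat.odd_iff.2 (by omega)) hi0)

lemma sqrt_iff (p q : ℕ) : (q : ℝ) ≤ Real.sqrt 3 * (p : ℝ) ↔ q ^ 2 ≤ 3 * p ^ 2 := by
  have e : Real.sqrt 3 * (p : ℝ) = Real.sqrt (3 * p ^ 2) := by
    rw [Real.sqrt_mul (by norm_num), Real.sqrt_sq (by positivity)]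
  rw [e, ← Real.sqrt_sq (Nat.cast_nonneg q : (0 : ℝ) ≤ q), Real.sqrt_le_sqrt_iff (by positivity)]
  exact_mod_cast Iff.rfl

/-- For `u = p₁p₂` with `p₁ < p₂` odd primes: `𝒩(u) = 0` if `p₁` or `p₂ ≡ 3 (mod 4)`
and `p₂ > √3·p₁`; `𝒩(u) = 2` if `p₁` or `p₂ ≡ 3 (mod 4)` and `p₂ ≤ √3·p₁`;
`𝒩(u) = 4` if `p₁ ≡ p₂ ≡ 1 (mod 4)` and `p₂ > √3·p₁`; `𝒩(u) = 6` if
`p₁ ≡ p₂ ≡ 1 (mod 4)` and `p₂ ≤ √3·p₁`. -/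
theorem stmt17 (p₁ p₂ : ℕ) (hp₁ : p₁.Prime) (hp₂ : p₂.Prime)
    (hodd₁ : Odd p₁) (hodd₂ : Odd p₂) (hlt : p₁ < p₂) (u : ℕ) (hu : u = p₁ * p₂) :
    ((p₁ % 4 = 3 ∨ p₂ % 4 = 3) → Real.sqrt 3 * (p₁ : ℝ) < (p₂ : ℝ) → NWR u = 0) ∧
    ((p₁ % 4 = 3 ∨ p₂ % 4 = 3) → (p₂ : ℝ) ≤ Real.sqrt 3 * (p₁ : ℝ) → NWR u = 2) ∧
    (p₁ % 4 = 1 → p₂ % 4 = 1 → Real.sqrt 3 * (p₁ : ℝ) < (p₂ : ℝ) → NWR u = 4) ∧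
    (p₁ % 4 = 1 → p₂ % 4 = 1 → (p₂ : ℝ) ≤ Real.sqrt 3 * (p₁ : ℝ) → NWR u = 6) := by
  subst hu
  rw [nwr_eq hp₁ hp₂ hodd₁ hodd₂ hlt, ← not_le, sqrt_iff]
  have : Fact p₁.Prime := ⟨hp₁⟩
  have : Fact p₂.Prime := ⟨hp₂⟩
  have h11 : (1 : ZMod p₁) ≠ -1 := neg_ne_self' hp₁ hodd₁ one_ne_zero
  have hpair : ({(1, -1), (-1, 1)} : Set (ZMod p₁ × ZMod p₂)).ncard = 2 := by
    apply Set.ncard_pair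
    intro h
    exact h11 (Prod.ext_iff.1 h).1
  have hprod : p₁ % 4 = 1 → p₂ % 4 = 1 →
      ({c : ZMod p₁ | c ^ 2 = -1} ×ˢ {c : ZMod p₂ | c ^ 2 = -1}).ncard = 4 := by
    intro h1 h2
    rw [Set.ncard_prod, roots_one hp₁ h1, roots_one hp₂ h2]
  have hnone : (p₁ % 4 = 3 ∨ p₂ % 4 = 3) → ∀ c : ZMod p₁ × ZMod p₂,
      ¬ (c.1 ^ 2 = -1 ∧ c.2 ^ 2 = -1) := by
    rintro (h | h) c ⟨h1, h2⟩
    · exact roots_three hp₁ h _ h1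
    · exact roots_three hp₂ h _ h2
  refine ⟨fun h h3 => ?_, fun h h3 => ?_, fun h1 h2 h3 => ?_, fun h1 h2 h3 => ?_⟩
  · have : {c | Good p₁ p₂ c} = ∅ := by
      ext c
      simp [Good, hnone h c, h3]
    rw [this, Set.ncard_empty]
  · rw [← hpair]
    congr 1
    ext c
    simp [Good, hnone h c, h3]
  · rw [← hprod h1 h2]
    congr 1
    ext c
    simp [Good, h3]
  · have : {c | Good p₁ p₂ c} = ({c : ZMod p₁ | c ^ 2 = -1} ×ˢ {c : ZMod p₂ | c ^ 2 = -1}) ∪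
        {(1, -1), (-1, 1)} := by
      ext c
      simp [Good, h3]
      tauto
    rw [this, Set.ncard_union_eq, hprod h1 h2, hpair]
    rw [Set.disjoint_left]
    rintro c ⟨hc, -⟩ (rfl | rfl)
    · exact h11 (by simpa using hc)
    · exact h11 (by simpa using hc)
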